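/- Let γ = (γ¹,γ²,γ³) : [0,1] → ℝ³ be twice continuously differentiable and horizontal. Then the Korányi length of γ is finite: L_K(γ) < ∞. -/

import Mathlib

open Set Filter

/-- A partition `a = t 0 < t 1 < ⋯ < t n = b` of the interval `[a,b]`. -/
def IsPartition (a b : ℝ) (n : ℕ) (t : ℕ → ℝ) : Prop :=
  t 0 = a ∧ t n = b ∧ ∀ i < n, t i < t (i + 1)

/-- The length of a curve `γ : [a,b] → X` in a metric space, as the supremum over
all partitions of the sums of distances of consecutive partition points. -/
noncomputable def curveLength {X : Type*} [MetricSpace X] (γ : ℝ → X) (a b : ℝ) : ENNReal :=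
  ⨆ (n : ℕ) (t : ℕ → ℝ) (_ : IsPartition a b n t),
    ENNReal.ofReal (∑ i ∈ Finset.range n, dist (γ (t (i + 1))) (γ (t i)))

/-- The Korányi distance on `ℝ³`. -/
noncomputable def dK (p q : EuclideanSpace ℝ (Fin 3)) : ℝ :=
  ((|p 0 - q 0| ^ 2 + |p 1 - q 1| ^ 2) ^ 2
    + |p 2 - q 2 + 2 * (p 1 * q 0 - p 0 * q 1)| ^ 2) ^ ((1 : ℝ) / 4)

/-- The Korányi length of a curve `γ : [a,b] → ℝ³`. -/
noncomputable def korLength (γ : ℝ → EuclideanSpace ℝ (Fin 3)) (a b : ℝ) : ENNReal :=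
  ⨆ (n : ℕ) (t : ℕ → ℝ) (_ : IsPartition a b n t),
    ENNReal.ofReal (∑ i ∈ Finset.range n, dK (γ (t (i + 1))) (γ (t i)))

/-- The point `(x,y,z) ∈ ℝ³`. -/
noncomputable def mk3 (x y z : ℝ) : EuclideanSpace ℝ (Fin 3) :=
  (WithLp.equiv 2 (Fin 3 → ℝ)).symm ![x, y, z]

/-- Mean value inequality for a differentiable function whose derivative is bounded on the open
interval. -/
theorem abs_sub_le_of_abs_deriv_le {f : ℝ → ℝ} {C s t : ℝ} (hf : Differentiable ℝ f)
    (hst : s < t) (hC : ∀ x ∈ Ioo s t, |deriv f x| ≤ C) : |f t - f s| ≤ C * (t - s) := by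
  obtain ⟨c, hc, h⟩ := exists_deriv_eq_slope f hst hf.continuous.continuousOn
    hf.differentiableOn
  have hpos : 0 < t - s := sub_pos.2 hst
  have h' : f t - f s = deriv f c * (t - s) := by
    rw [h]; field_simp
  rw [h', abs_mul, abs_of_pos hpos]
  exact mul_le_mul_of_nonneg_right (hC c hc) hpos.le

/-- The vertical component of the Korányi distance along a horizontal curve is quadratically
small. -/
theorem abs_vertical_le_of_horizontal {γ₁ γ₂ γ₃ : ℝ → ℝ} {M s t : ℝ}
    (h₁ : Differentiable ℝ γ₁) (h₂ : Differentiable ℝ γ₂) (h₃ : Differentiable ℝ γ₃)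
    (hst : s < t)
    (hhor : ∀ x ∈ Ioo s t, deriv γ₃ x = -2 * (γ₁ x * deriv γ₂ x - γ₂ x * deriv γ₁ x))
    (hM₁ : ∀ x ∈ Ioo s t, |deriv γ₁ x| ≤ M) (hM₂ : ∀ x ∈ Ioo s t, |deriv γ₂ x| ≤ M) :
    |γ₃ t - γ₃ s + 2 * (γ₂ t * γ₁ s - γ₁ t * γ₂ s)| ≤ 4 * M ^ 2 * (t - s) ^ 2 := by
  have hderiv : ∀ x, HasDerivAt (fun x => γ₃ x + 2 * (γ₂ x * γ₁ s - γ₁ x * γ₂ s))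
      (deriv γ₃ x + 2 * (deriv γ₂ x * γ₁ s - deriv γ₁ x * γ₂ s)) x := fun x =>
    (h₃ x).hasDerivAt.add
      ((((h₂ x).hasDerivAt.mul_const _).sub ((h₁ x).hasDerivAt.mul_const _)).const_mul 2)
  have key := abs_sub_le_of_abs_deriv_le (C := 4 * M ^ 2 * (t - s))
    (fun x => (hderiv x).differentiableAt) hst (fun x hx => by
      have hsub : Ioo s x ⊆ Ioo s t := Ioo_subset_Ioo_right hx.2.le
      have b₁ := abs_sub_le_of_abs_deriv_le h₁ hx.1 (fun y hy => hM₁ y (hsub hy))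
      have b₂ := abs_sub_le_of_abs_deriv_le h₂ hx.1 (fun y hy => hM₂ y (hsub hy))
      have hM : 0 ≤ M := (abs_nonneg _).trans (hM₁ x hx)
      have hle : M * (x - s) ≤ M * (t - s) :=
        mul_le_mul_of_nonneg_left (by linarith [hx.2]) hM
      have c₁ := mul_le_mul (hM₁ x hx) (b₂.trans hle) (abs_nonneg _) hM
      have c₂ := mul_le_mul (hM₂ x hx) (b₁.trans hle) (abs_nonneg _) hM
      rw [← abs_mul] at c₁ c₂
      rw [(hderiv x).deriv, hhor x hx, abs_le]
      rw [abs_le] at c₁ c₂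
      constructor <;> nlinarith [c₁.1, c₁.2, c₂.1, c₂.2])
  calc _ = |γ₃ t + 2 * (γ₂ t * γ₁ s - γ₁ t * γ₂ s)
        - (γ₃ s + 2 * (γ₂ s * γ₁ s - γ₁ s * γ₂ s))| := by ring_nf
    _ ≤ 4 * M ^ 2 * (t - s) * (t - s) := key
    _ = _ := by ring

/-- A bound for the Korányi distance at scale `r`. -/
theorem dK_mk3_le {x y z x' y' z' r : ℝ} (hr : 0 ≤ r) (hx : |x - x'| ≤ r) (hy : |y - y'| ≤ r)
    (hz : |z - z' + 2 * (y * x' - x * y')| ≤ 4 * r ^ 2) :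
    dK (mk3 x y z) (mk3 x' y' z') ≤ 3 * r := by
  have e : dK (mk3 x y z) (mk3 x' y' z') = ((|x - x'| ^ 2 + |y - y'| ^ 2) ^ 2
      + |z - z' + 2 * (y * x' - x * y')| ^ 2) ^ ((1 : ℝ) / 4) := by
    simp [dK, mk3]
  have hb : (|x - x'| ^ 2 + |y - y'| ^ 2) ^ 2 + |z - z' + 2 * (y * x' - x * y')| ^ 2
      ≤ (3 * r) ^ 4 := by
    calc _ ≤ (r ^ 2 + r ^ 2) ^ 2 + (4 * r ^ 2) ^ 2 := by gcongr
      _ ≤ _ := by nlinarith [pow_nonneg hr 4]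
  rw [e]
  calc _ ≤ ((3 * r) ^ 4) ^ ((1 : ℝ) / 4) :=
        Real.rpow_le_rpow (by positivity) hb (by norm_num)
    _ = 3 * r := by
        have := Real.pow_rpow_inv_natCast (x := 3 * r) (n := 4) (by positivity) (by norm_num)
        simpa using this

/-- The points of a partition of `[a,b]` lie in `[a,b]`. -/
theorem IsPartition.mem_Icc {a b : ℝ} {n : ℕ} {t : ℕ → ℝ} (h : IsPartition a b n t) {i : ℕ}
    (hi : i ≤ n) : t i ∈ Icc a b := by
  obtain ⟨h0, hn, hlt⟩ := h
  constructor
  · induction i with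
    | zero => exact h0.ge
    | succ k ih => exact (ih (by omega)).trans (hlt k (by omega)).le
  · induction hi using Nat.decreasingInduction with
    | self => exact hn.le
    | of_succ k hk ih => exact (hlt k hk).le.trans ih

/-- If the Korányi distance along a curve is controlled by the parameter, its Korányi length
is finite. -/
theorem korLength_ne_top_of_dK_le {γ : ℝ → EuclideanSpace ℝ (Fin 3)} {a b C : ℝ}
    (h : ∀ s ∈ Icc a b, ∀ t ∈ Icc a b, s < t → dK (γ t) (γ s) ≤ C * (t - s)) :
    korLength γ a b ≠ ⊤ := by
  refine ne_top_of_le_ne_top (ENNReal.ofReal_ne_top (r := C * (b - a))) ?_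
  refine iSup_le fun n => iSup_le fun t => iSup_le fun ht => ENNReal.ofReal_le_ofReal ?_
  calc _ ≤ ∑ i ∈ Finset.range n, C * (t (i + 1) - t i) := by
        refine Finset.sum_le_sum fun i hi => ?_
        have hi := Finset.mem_range.1 hi
        exact h _ (ht.mem_Icc hi.le) _ (ht.mem_Icc hi) (ht.2.2 i hi)
    _ = C * (b - a) := by
        rw [← Finset.mul_sum, Finset.sum_range_sub, ht.1, ht.2.1]

/-- a twice continuously differentiable horizontal curve has finite
Korányi length. -/
theorem korLength_finite_of_horizontal (γ₁ γ₂ γ₃ : ℝ → ℝ)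
    (h₁ : ContDiff ℝ 2 γ₁) (h₂ : ContDiff ℝ 2 γ₂) (h₃ : ContDiff ℝ 2 γ₃)
    (hhor : ∀ t ∈ Ioo (0 : ℝ) 1,
      deriv γ₃ t = -2 * (γ₁ t * deriv γ₂ t - γ₂ t * deriv γ₁ t)) :
    korLength (fun t => mk3 (γ₁ t) (γ₂ t) (γ₃ t)) 0 1 ≠ ⊤ := by
  have hc₁ : Continuous (deriv γ₁) := h₁.continuous_deriv (by norm_num)
  have hc₂ : Continuous (deriv γ₂) := h₂.continuous_deriv (by norm_num)
  have hd₁ : Differentiable ℝ γ₁ := h₁.differentiable (by norm_num)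
  have hd₂ : Differentiable ℝ γ₂ := h₂.differentiable (by norm_num)
  have hd₃ : Differentiable ℝ γ₃ := h₃.differentiable (by norm_num)
  obtain ⟨A, hA⟩ := (isCompact_Icc (a := (0 : ℝ)) (b := 1)).exists_bound_of_continuousOn
    hc₁.continuousOn
  obtain ⟨B, hB⟩ := (isCompact_Icc (a := (0 : ℝ)) (b := 1)).exists_bound_of_continuousOn
    hc₂.continuousOn
  refine korLength_ne_top_of_dK_le (C := 3 * max A B) fun s hs t ht hst => ?_
  have hsub : Ioo s t ⊆ Ioo 0 1 := Ioo_subset_Ioo hs.1 ht.2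
  have hM₁ : ∀ x ∈ Ioo s t, |deriv γ₁ x| ≤ max A B := fun x hx =>
    (hA x (Ioo_subset_Icc_self (hsub hx))).trans (le_max_left _ _)
  have hM₂ : ∀ x ∈ Ioo s t, |deriv γ₂ x| ≤ max A B := fun x hx =>
    (hB x (Ioo_subset_Icc_self (hsub hx))).trans (le_max_right _ _)
  have hM : 0 ≤ max A B := ((norm_nonneg _).trans (hA s hs)).trans (le_max_left _ _)
  rw [mul_assoc]
  refine dK_mk3_le (mul_nonneg hM (sub_nonneg.2 hst.le))
    (abs_sub_le_of_abs_deriv_le hd₁ hst hM₁) (abs_sub_le_of_abs_deriv_le hd₂ hst hM₂) ?_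
  rw [mul_pow, ← mul_assoc]
  exact abs_vertical_le_of_horizontal hd₁ hd₂ hd₃ hst (fun x hx => hhor x (hsub hx)) hM₁ hM₂
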